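/- Let n ≥ 1, 0 ≤ ρ ≤ 1 and 0 < ε ≤ 1, and let ω : [0,∞) → [0,∞) be non-decreasing, bounded and non-negative with ∫₀¹ ω(t) t⁻¹ dt < ∞. Let σ : ℝⁿ × ℝⁿ → ℂ be a symbol, smooth in ξ, for which there is C > 0 such that |∂_ξ^α σ(x,ξ)| ≤ C ω(⟨ξ⟩^{−ε}) ⟨ξ⟩^{−(n/2)(1−ρ) − ρ|α|} for all (x,ξ) ∈ ℝⁿ × ℝⁿ and all multi-indices α with |α| ≤ [n/2]+1. Then the pseudo-differential operator T_σ is a bounded operator on L^p(ℝⁿ) for every 2 ≤ p ≤ ∞. -/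

import Mathlib

open MeasureTheory Real ENNReal

noncomputable section

/-- Partial derivative of a complex-valued function on `ℝⁿ` in the `j`-th coordinate
direction. -/
def pd {n : ℕ} (j : Fin n) (f : (Fin n → ℝ) → ℂ) : (Fin n → ℝ) → ℂ :=
  fun x => fderiv ℝ f x (Pi.single j 1)

/-- The canonical list of directions associated to a multi-index `β ∈ ℕⁿ`. -/
def mIdxList {n : ℕ} (β : Fin n → ℕ) : List (Fin n) :=
  (List.finRange n).flatMap fun j => List.replicate (β j) j

/-- Iterated partial derivative `∂^β` associated to a multi-index `β`. -/
def pdM {n : ℕ} (β : Fin n → ℕ) (f : (Fin n → ℝ) → ℂ) : (Fin n → ℝ) → ℂ :=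
  (mIdxList β).foldr pd f

/-- Forward difference operator in the `j`-th direction on functions of `ξ ∈ ℤⁿ`. -/
def dd {n : ℕ} (j : Fin n) (g : (Fin n → ℤ) → ℂ) : (Fin n → ℤ) → ℂ :=
  fun ξ => g (ξ + Pi.single j 1) - g ξ

/-- Iterated difference operator `Δ_ξ^α` associated to a multi-index `α`. -/
def ddM {n : ℕ} (α : Fin n → ℕ) (g : (Fin n → ℤ) → ℂ) : (Fin n → ℤ) → ℂ :=
  (mIdxList α).foldr dd g

/-- Japanese bracket `⟨ξ⟩ = (1+|ξ|²)^{1/2}` of a lattice point `ξ ∈ ℤⁿ`. -/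
def jb {n : ℕ} (ξ : Fin n → ℤ) : ℝ := Real.sqrt (1 + ∑ j, ((ξ j : ℝ)) ^ 2)

/-- Japanese bracket `⟨ξ⟩ = (1+|ξ|²)^{1/2}` of a vector `ξ ∈ ℝⁿ`. -/
def jbR {n : ℕ} (ξ : Fin n → ℝ) : ℝ := Real.sqrt (1 + ∑ j, (ξ j) ^ 2)

/-- The canonical embedding `ℤⁿ → ℝⁿ`. -/
def castZ {n : ℕ} (ξ : Fin n → ℤ) : Fin n → ℝ := fun j => (ξ j : ℝ)

/-- The fundamental domain `[0,1)ⁿ` of the torus `𝕋ⁿ = ℝⁿ/ℤⁿ`. -/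
def cube (n : ℕ) : Set (Fin n → ℝ) := Set.univ.pi fun _ => Set.Ico (0 : ℝ) 1

/-- The normalized Lebesgue measure of the torus `𝕋ⁿ`, realized as the Lebesgue measure
on `ℝⁿ` restricted to the fundamental domain `[0,1)ⁿ`. -/
def μT (n : ℕ) : Measure (Fin n → ℝ) := volume.restrict (cube n)

/-- `1`-periodicity of a function on `ℝⁿ` (i.e. the function descends to `𝕋ⁿ`). -/
def Per {n : ℕ} (f : (Fin n → ℝ) → ℂ) : Prop :=
  ∀ (x : Fin n → ℝ) (v : Fin n → ℤ), f (x + fun j => (v j : ℝ)) = f x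

/-- The character `e^{2πi⟨x,ξ⟩}`. -/
def eChar {n : ℕ} (x : Fin n → ℝ) (ξ : Fin n → ℤ) : ℂ :=
  Complex.exp (2 * (π : ℂ) * Complex.I * ∑ j, (x j : ℂ) * (ξ j : ℂ))

/-- Fourier coefficient `f̂(ξ) = ∫_{𝕋ⁿ} e^{-2πi⟨x,ξ⟩} f(x) dx` of a function on `𝕋ⁿ`. -/
def fc {n : ℕ} (f : (Fin n → ℝ) → ℂ) (ξ : Fin n → ℤ) : ℂ :=
  ∫ x, Complex.exp (-(2 * (π : ℂ) * Complex.I) * ∑ j, (x j : ℂ) * (ξ j : ℂ)) * f x ∂(μT n)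

/-- Periodic pseudo-differential operator
    `σ(x,D)f(x) = Σ_{ξ ∈ ℤⁿ} e^{2πi⟨x,ξ⟩} σ(x,ξ) f̂(ξ)`
with symbol `σ` on `𝕋ⁿ × ℤⁿ`. -/
def Op {n : ℕ} (σ : (Fin n → ℝ) → (Fin n → ℤ) → ℂ) (f : (Fin n → ℝ) → ℂ) :
    (Fin n → ℝ) → ℂ :=
  fun x => ∑' ξ : Fin n → ℤ, eChar x ξ * σ x ξ * fc f ξ

/-- The `L^p(𝕋ⁿ)` norm, for a real exponent `p`. -/
def lpT (n : ℕ) (p : ℝ) (g : (Fin n → ℝ) → ℂ) : ℝ :=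
  (∫ x, ‖g x‖ ^ p ∂(μT n)) ^ (1 / p)

/-- `∂_x^β Δ_ξ^α σ(x,ξ)` for a symbol `σ` on `𝕋ⁿ × ℤⁿ` (difference operator applied first,
then the derivatives in `x`). -/
def symbDxD {n : ℕ} (β α : Fin n → ℕ) (σ : (Fin n → ℝ) → (Fin n → ℤ) → ℂ)
    (x : Fin n → ℝ) (ξ : Fin n → ℤ) : ℂ :=
  pdM β (fun x' => ddM α (σ x') ξ) x

/-- `Δ_ξ^α ∂_x^β σ(x,ξ)` for a symbol `σ` on `𝕋ⁿ × ℤⁿ` (derivatives in `x` applied first,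
then the difference operator in `ξ`). -/
def symbDDx {n : ℕ} (α β : Fin n → ℕ) (σ : (Fin n → ℝ) → (Fin n → ℤ) → ℂ)
    (x : Fin n → ℝ) (ξ : Fin n → ℤ) : ℂ :=
  ddM α (fun ξ' => pdM β (fun x' => σ x' ξ') x) ξ

/-- `∂_ξ^α ∂_x^β σ(x,ξ)` for a symbol `σ` on `𝕋ⁿ × ℝⁿ` (derivatives in `x` applied first,
then the derivatives in `ξ`). -/
def symbDξDx {n : ℕ} (α β : Fin n → ℕ) (σ : (Fin n → ℝ) → (Fin n → ℝ) → ℂ)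
    (x ξ : Fin n → ℝ) : ℂ :=
  pdM α (fun ξ' => pdM β (fun x' => σ x' ξ') x) ξ

/-- `∂_x^β ∂_ξ^α σ(x,ξ)` for a symbol `σ` on `𝕋ⁿ × ℝⁿ` (derivatives in `ξ` applied first,
then the derivatives in `x`). -/
def symbDxDξ {n : ℕ} (β α : Fin n → ℕ) (σ : (Fin n → ℝ) → (Fin n → ℝ) → ℂ)
    (x ξ : Fin n → ℝ) : ℂ :=
  pdM β (fun x' => pdM α (σ x') ξ) x

/-- The Euclidean Fourier transform `û(ξ) = ∫_{ℝⁿ} e^{-2πi⟨x,ξ⟩} u(x) dx`. -/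
def FT {n : ℕ} (u : (Fin n → ℝ) → ℂ) (ξ : Fin n → ℝ) : ℂ :=
  ∫ x, Complex.exp (-(2 * (π : ℂ) * Complex.I) * ∑ j, (x j : ℂ) * (ξ j : ℂ)) * u x

/-- Pseudo-differential operator on `ℝⁿ`:
`T_σ u(x) = ∫_{ℝⁿ} e^{2πi⟨x,ξ⟩} σ(x,ξ) û(ξ) dξ`. -/
def OpR {n : ℕ} (σ : (Fin n → ℝ) → (Fin n → ℝ) → ℂ) (u : (Fin n → ℝ) → ℂ) :
    (Fin n → ℝ) → ℂ :=
  fun x => ∫ ξ, Complex.exp (2 * (π : ℂ) * Complex.I * ∑ j, (x j : ℂ) * (ξ j : ℂ)) * σ x ξ * FT u ξ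

/-- Periodic amplitude operator
`a(x,y,D)u(x) = ∫_{𝕋ⁿ} ∫_{ℝⁿ} e^{2πi⟨x-y,ξ⟩} a(x,y,ξ) u(y) dξ dy`. -/
def OpAmp {n : ℕ} (a : (Fin n → ℝ) → (Fin n → ℝ) → (Fin n → ℝ) → ℂ)
    (u : (Fin n → ℝ) → ℂ) : (Fin n → ℝ) → ℂ :=
  fun x => ∫ y,
    (∫ ξ, Complex.exp (2 * (π : ℂ) * Complex.I * ∑ j, ((x j : ℂ) - (y j : ℂ)) * (ξ j : ℂ)) *
        a x y ξ) * u y ∂(μT n)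

/-- The `L^p(ℝⁿ)` norm, for a real exponent `p`. -/
def lpR (n : ℕ) (p : ℝ) (g : (Fin n → ℝ) → ℂ) : ℝ :=
  (∫ x, ‖g x‖ ^ p) ^ (1 / p)


section

open SchwartzMap FourierTransform LineDeriv

/-- A Schwartz function on `ℝⁿ` seen as a Schwartz function on Euclidean space. -/
def toEuclideanSchwartz {n : ℕ} (g : SchwartzMap (Fin n → ℝ) ℂ) :
    SchwartzMap (EuclideanSpace ℝ (Fin n)) ℂ :=
  SchwartzMap.compCLMOfContinuousLinearEquiv ℂ (EuclideanSpace.equiv (Fin n) ℝ) g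

lemma toEuclideanSchwartz_apply {n : ℕ} (g : SchwartzMap (Fin n → ℝ) ℂ)
    (v : EuclideanSpace ℝ (Fin n)) : toEuclideanSchwartz g v = g (WithLp.ofLp v) := rfl

lemma FT_eq_fourier {n : ℕ} (g : SchwartzMap (Fin n → ℝ) ℂ) (y : Fin n → ℝ) :
    FT g y = 𝓕 (toEuclideanSchwartz g) (WithLp.toLp 2 y) := by
  rw [SchwartzMap.fourier_coe, Real.fourier_eq', FT,
    ← (PiLp.volume_preserving_ofLp (Fin n)).integral_comp
      (MeasurableEquiv.toLp 2 (Fin n → ℝ)).symm.measurableEmbedding]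
  refine integral_congr_ae (Filter.Eventually.of_forall fun v => ?_)
  simp only [toEuclideanSchwartz_apply, PiLp.inner_apply, smul_eq_mul]
  congr 2
  simp [mul_comm, mul_assoc]

/-- The Fourier transform of a Schwartz function on `ℝⁿ`, as a Schwartz function. -/
def schwartzFT {n : ℕ} (g : SchwartzMap (Fin n → ℝ) ℂ) : SchwartzMap (Fin n → ℝ) ℂ :=
  SchwartzMap.compCLMOfContinuousLinearEquiv ℂ (EuclideanSpace.equiv (Fin n) ℝ).symm
    (𝓕 (toEuclideanSchwartz g))

lemma coe_schwartzFT {n : ℕ} (g : SchwartzMap (Fin n → ℝ) ℂ) : ⇑(schwartzFT g) = FT g := by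
  ext y
  rw [FT_eq_fourier]
  rfl

lemma integral_norm_sq_FT {n : ℕ} (g : SchwartzMap (Fin n → ℝ) ℂ) :
    ∫ y, ‖FT g y‖ ^ 2 = ∫ ξ, ‖g ξ‖ ^ 2 := by
  have h := SchwartzMap.integral_norm_sq_fourier (toEuclideanSchwartz g)
  have e := (MeasurableEquiv.toLp 2 (Fin n → ℝ)).symm.measurableEmbedding
  rw [← (PiLp.volume_preserving_ofLp (Fin n)).integral_comp e (fun y => ‖FT g y‖ ^ 2),
    ← (PiLp.volume_preserving_ofLp (Fin n)).integral_comp e (fun ξ => ‖g ξ‖ ^ 2)]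
  simp only [FT_eq_fourier]
  exact h

lemma SchwartzMap.lintegral_enorm_sq {n : ℕ} (g : SchwartzMap (Fin n → ℝ) ℂ) :
    ∫⁻ y, ‖g y‖ₑ ^ 2 = ENNReal.ofReal (∫ y, ‖g y‖ ^ 2) := by
  have h : Integrable (fun y => ‖g y‖ ^ 2) :=
    (memLp_two_iff_integrable_sq_norm g.continuous.aestronglyMeasurable).1 (g.memLp 2)
  rw [ofReal_integral_eq_lintegral_ofReal h (Filter.Eventually.of_forall fun _ => by positivity)]
  simp [ENNReal.ofReal_pow]

lemma lintegral_enorm_sq_FT {n : ℕ} (g : SchwartzMap (Fin n → ℝ) ℂ) :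
    ∫⁻ y, ‖FT g y‖ₑ ^ 2 = ∫⁻ ξ, ‖g ξ‖ₑ ^ 2 := by
  rw [← coe_schwartzFT, SchwartzMap.lintegral_enorm_sq, SchwartzMap.lintegral_enorm_sq,
    coe_schwartzFT, integral_norm_sq_FT]

lemma FT_lineDeriv {n : ℕ} (g : SchwartzMap (Fin n → ℝ) ℂ) (k : Fin n) (y : Fin n → ℝ) :
    FT (∂_{(Pi.single k 1 : Fin n → ℝ)} g : SchwartzMap (Fin n → ℝ) ℂ) y =
      2 * π * Complex.I * y k * FT g y := by
  have h : toEuclideanSchwartz (∂_{(Pi.single k 1 : Fin n → ℝ)} g) =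
      ∂_{EuclideanSpace.single k (1 : ℝ)} (toEuclideanSchwartz g) := by
    rw [toEuclideanSchwartz, toEuclideanSchwartz,
      SchwartzMap.lineDerivOp_compCLMOfContinuousLinearEquiv]
    rfl
  have ht : (fun x : EuclideanSpace ℝ (Fin n) =>
      inner ℝ x (EuclideanSpace.single k (1 : ℝ))).HasTemperateGrowth := by fun_prop
  rw [FT_eq_fourier, FT_eq_fourier, h, SchwartzMap.fourier_lineDerivOp_eq]
  rw [smul_apply, SchwartzMap.smulLeftCLM_apply_apply ht,
    EuclideanSpace.inner_single_right]
  simp [mul_assoc]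

lemma coe_lineDeriv_iterate {n : ℕ} (g : SchwartzMap (Fin n → ℝ) ℂ) (k : Fin n) (m : ℕ) :
    ⇑((fun f : SchwartzMap (Fin n → ℝ) ℂ => ∂_{(Pi.single k 1 : Fin n → ℝ)} f)^[m] g) =
      (pd k)^[m] g := by
  induction m with
  | zero => rfl
  | succ m ih =>
    rw [Function.iterate_succ_apply', Function.iterate_succ_apply', ← ih]
    rfl

lemma norm_FT_lineDeriv_iterate {n : ℕ} (g : SchwartzMap (Fin n → ℝ) ℂ) (k : Fin n) (m : ℕ)
    (y : Fin n → ℝ) :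
    ‖FT ((fun f : SchwartzMap (Fin n → ℝ) ℂ => ∂_{(Pi.single k 1 : Fin n → ℝ)} f)^[m] g) y‖ =
      (2 * π) ^ m * |y k| ^ m * ‖FT g y‖ := by
  have h : FT ((fun f : SchwartzMap (Fin n → ℝ) ℂ =>
      ∂_{(Pi.single k 1 : Fin n → ℝ)} f)^[m] g) y = (2 * π * Complex.I * y k) ^ m * FT g y := by
    induction m with
    | zero => simp
    | succ m ih => rw [Function.iterate_succ_apply', FT_lineDeriv, ih, pow_succ']; ring
  simp [h, abs_of_pos Real.pi_pos, mul_pow]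

lemma integral_mul_FT {n : ℕ} {f g : (Fin n → ℝ) → ℂ} (hf : Integrable f) (hg : Integrable g) :
    ∫ ξ, f ξ * FT g ξ = ∫ y, FT f y * g y := by
  have key (f : (Fin n → ℝ) → ℂ) : FT f =
      VectorFourier.fourierIntegral 𝐞 volume (dotProductBilin ℝ ℝ : (Fin n → ℝ) →ₗ[ℝ] _) f := by
    ext y
    rw [FT, VectorFourier.fourierIntegral]
    refine integral_congr_ae (Filter.Eventually.of_forall fun v => ?_)
    simp only [Circle.smul_def, Real.fourierChar_apply, dotProductBilin_apply_apply, dotProduct,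
      smul_eq_mul]
    congr 2
    push_cast
    ring
  have hc : Continuous fun p : (Fin n → ℝ) × (Fin n → ℝ) =>
      (dotProductBilin ℝ ℝ : (Fin n → ℝ) →ₗ[ℝ] _) p.1 p.2 := by
    simp only [dotProductBilin_apply_apply, dotProduct]
    fun_prop
  have hflip : (dotProductBilin ℝ ℝ : (Fin n → ℝ) →ₗ[ℝ] (Fin n → ℝ) →ₗ[ℝ] ℝ).flip =
      dotProductBilin ℝ ℝ := by
    ext
    simp [dotProduct_comm]
  have h := VectorFourier.integral_fourierIntegral_smul_eq_flip (μ := volume) (ν := volume)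
    Real.continuous_fourierChar hc hf hg
  rw [hflip, ← key, ← key] at h
  simpa using h.symm

lemma FT_comp_add {n : ℕ} (u : (Fin n → ℝ) → ℂ) (x ξ : Fin n → ℝ) :
    FT (fun z => u (x + z)) ξ =
      Complex.exp (2 * (π : ℂ) * Complex.I * ∑ j, (x j : ℂ) * (ξ j : ℂ)) * FT u ξ := by
  rw [FT, FT, ← integral_const_mul, ← integral_add_left_eq_self _ (-x)]
  refine integral_congr_ae (Filter.Eventually.of_forall fun z => ?_)
  simp only [add_neg_cancel_left, ← mul_assoc, ← Complex.exp_add]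
  congr 2
  simp only [Pi.add_apply, Pi.neg_apply]
  push_cast
  simp only [add_mul, Finset.sum_add_distrib, neg_mul, Finset.sum_neg_distrib]
  ring

lemma ContDiff.pd {n : ℕ} {f : (Fin n → ℝ) → ℂ} (hf : ContDiff ℝ (⊤ : ℕ∞) f) (k : Fin n) :
    ContDiff ℝ (⊤ : ℕ∞) (pd k f) :=
  (hf.fderiv_right (m := (⊤ : ℕ∞)) le_rfl).clm_apply contDiff_const

lemma ContDiff.pd_iterate {n : ℕ} {f : (Fin n → ℝ) → ℂ} (hf : ContDiff ℝ (⊤ : ℕ∞) f)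
    (k : Fin n) (m : ℕ) : ContDiff ℝ (⊤ : ℕ∞) ((_root_.pd k)^[m] f) := by
  induction m with
  | zero => exact hf
  | succ m ih => rw [Function.iterate_succ_apply']; exact ih.pd k

lemma pdM_single {n : ℕ} (k : Fin n) (m : ℕ) (f : (Fin n → ℝ) → ℂ) :
    pdM (Pi.single k m) f = (pd k)^[m] f := by
  have h : mIdxList (Pi.single k m : Fin n → ℕ) = List.replicate m k := by
    rw [mIdxList, List.eq_replicate_iff]
    constructor
    · simp [List.length_flatMap, ← List.ofFn_eq_map, List.sum_ofFn]
    · intro j hj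
      obtain ⟨i, -, hi⟩ := List.mem_flatMap.1 hj
      obtain ⟨h0, rfl⟩ := List.mem_replicate.1 hi
      by_contra hne
      exact h0 (by simp [hne])
  rw [pdM, h]
  induction m with
  | zero => rfl
  | succ m ih =>
    rw [List.replicate_succ, List.foldr_cons, Function.iterate_succ_apply']
    congr 1
    clear ih h
    induction m with
    | zero => rfl
    | succ m ih => rw [List.replicate_succ, List.foldr_cons, Function.iterate_succ_apply', ih]

lemma iteratedDeriv_line {n : ℕ} {f : (Fin n → ℝ) → ℂ} (hf : ContDiff ℝ (⊤ : ℕ∞) f)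
    (k : Fin n) (m : ℕ) (ξ : Fin n → ℝ) :
    iteratedDeriv m (fun t : ℝ => f (ξ + t • Pi.single k 1)) =
      fun t => (pd k)^[m] f (ξ + t • Pi.single k 1) := by
  induction m with
  | zero => simp
  | succ m ih =>
    rw [iteratedDeriv_succ, ih, Function.iterate_succ_apply']
    ext t
    have h1 : HasDerivAt (fun t : ℝ => ξ + t • (Pi.single k 1 : Fin n → ℝ)) (Pi.single k 1) t := by
      simpa using ((hasDerivAt_id t).smul_const (Pi.single k 1 : Fin n → ℝ)).const_add ξ
    have h2 := ((hf.pd_iterate k m).differentiable (by simp)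
      (ξ + t • Pi.single k 1)).hasFDerivAt
    exact (h2.comp_hasDerivAt t h1).deriv

lemma norm_pd_iterate_mul_le {n : ℕ} {f g : (Fin n → ℝ) → ℂ} (hf : ContDiff ℝ (⊤ : ℕ∞) f)
    (hg : ContDiff ℝ (⊤ : ℕ∞) g) (k : Fin n) (m : ℕ) (ξ : Fin n → ℝ) :
    ‖(pd k)^[m] (fun ξ => f ξ * g ξ) ξ‖ ≤ ∑ i ∈ Finset.range (m + 1),
      (m.choose i : ℝ) * ‖(pd k)^[i] f ξ‖ * ‖(pd k)^[m - i] g ξ‖ := by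
  have hl : ContDiff ℝ (⊤ : ℕ∞) (fun t : ℝ => ξ + t • (Pi.single k 1 : Fin n → ℝ)) := by fun_prop
  have h := norm_iteratedFDeriv_mul_le (hf.comp hl) (hg.comp hl) (0 : ℝ) (n := m)
    (by exact_mod_cast le_top)
  simp only [norm_iteratedFDeriv_eq_norm_iteratedDeriv] at h
  have e := congrFun (iteratedDeriv_line (hf.mul hg) k m ξ) 0
  simp only [zero_smul, add_zero] at e
  simp only [Function.comp_def, iteratedDeriv_line hf, iteratedDeriv_line hg, zero_smul,
    add_zero] at h
  rw [← e]
  exact h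

lemma pd_iterate_comp_smul {n : ℕ} (θ : (Fin n → ℝ) → ℂ) (c : ℝ) (k : Fin n) (m : ℕ) :
    (pd k)^[m] (fun ξ => θ (c • ξ)) = fun ξ => (c : ℂ) ^ m * (pd k)^[m] θ (c • ξ) := by
  induction m with
  | zero => simp
  | succ m ih =>
    rw [Function.iterate_succ_apply', Function.iterate_succ_apply', ih]
    ext ξ
    have h1 := fderiv_comp_smul (𝕜 := ℝ) (f := (pd k)^[m] θ) (x := ξ) c
    have h2 : (fun ξ => (c : ℂ) ^ m * (pd k)^[m] θ (c • ξ)) =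
        ((c : ℂ) ^ m) • (fun ξ => (pd k)^[m] θ (c • ξ)) := rfl
    simp only [pd]
    rw [h2, fderiv_const_smul_field]
    simp only [FunLike.coe_smul, Pi.smul_apply]
    rw [h1]
    simp [pow_succ, mul_assoc]

lemma tsupport_pd_iterate_subset {n : ℕ} (g : (Fin n → ℝ) → ℂ) (k : Fin n) (m : ℕ) :
    tsupport ((pd k)^[m] g) ⊆ tsupport g := by
  induction m with
  | zero => rfl
  | succ m ih =>
    rw [Function.iterate_succ_apply']
    exact (tsupport_fderiv_apply_subset ℝ _).trans ih

lemma exists_pd_iterate_bound {n : ℕ} {θ : (Fin n → ℝ) → ℂ} (hθ : ContDiff ℝ (⊤ : ℕ∞) θ)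
    (hc : HasCompactSupport θ) (N : ℕ) :
    ∃ B : ℝ, 0 ≤ B ∧ ∀ m ≤ N, ∀ (k : Fin n) (ξ), ‖(pd k)^[m] θ ξ‖ ≤ B := by
  have h (m : ℕ) (k : Fin n) : ∃ B : ℝ, ∀ ξ, ‖(pd k)^[m] θ ξ‖ ≤ B :=
    (hθ.pd_iterate k m).continuous.bounded_above_of_compact_support
      (hc.of_isClosed_subset (isClosed_tsupport _) (tsupport_pd_iterate_subset θ k m))
  choose B hB using h
  refine ⟨∑ m ∈ Finset.range (N + 1), ∑ k, |B m k|, by positivity, fun m hm k ξ => ?_⟩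
  calc ‖(pd k)^[m] θ ξ‖ ≤ |B m k| := (hB m k ξ).trans (le_abs_self _)
    _ ≤ ∑ k, |B m k| := Finset.single_le_sum (f := fun k => |B m k|)
        (fun _ _ => abs_nonneg _) (Finset.mem_univ k)
    _ ≤ _ := Finset.single_le_sum (f := fun m => ∑ k, |B m k|)
        (fun _ _ => Finset.sum_nonneg fun _ _ => abs_nonneg _) (Finset.mem_range.2 (by omega))

/-- The polynomial weight `1 + ∑ₖ |zₖ|^{2N}`. -/
def polyWeight {n : ℕ} (N : ℕ) (z : Fin n → ℝ) : ℝ := 1 + ∑ k, (|z k| ^ N) ^ 2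

lemma polyWeight_pos {n : ℕ} (N : ℕ) (z : Fin n → ℝ) : 0 < polyWeight N z := by
  unfold polyWeight; positivity

lemma continuous_polyWeight {n : ℕ} (N : ℕ) : Continuous (polyWeight N : (Fin n → ℝ) → ℝ) := by
  unfold polyWeight; fun_prop

lemma lintegral_inv_polyWeight_lt_top {n N : ℕ} (hN : n < 2 * N) :
    ∫⁻ z : Fin n → ℝ, ENNReal.ofReal (polyWeight N z)⁻¹ < ∞ := by
  have h_int : Integrable (fun z : Fin n → ℝ => (1 + ‖z‖) ^ (-((2 * N : ℕ) : ℝ))) :=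
    integrable_one_add_norm (by simpa using mod_cast hN)
  have hle (z : Fin n → ℝ) :
      (polyWeight N z)⁻¹ ≤ 2 ^ (2 * N) * (1 + ‖z‖) ^ (-((2 * N : ℕ) : ℝ)) := by
    have h1 : ‖z‖ ^ (2 * N) ≤ ∑ k, (|z k| ^ N) ^ 2 := by
      rcases isEmpty_or_nonempty (Fin n) with h | h
      · rw [Subsingleton.elim z 0]
        have : N ≠ 0 := by omega
        simp [this]
      · obtain ⟨k, -, hk⟩ := Finset.exists_mem_eq_sup' Finset.univ_nonempty fun k => ‖z k‖₊
        have hk' : ‖z‖ = |z k| := by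
          rw [Pi.norm_def, ← Finset.sup'_eq_sup Finset.univ_nonempty, hk, coe_nnnorm,
            Real.norm_eq_abs]
        rw [hk', mul_comm 2 N, pow_mul]
        exact Finset.single_le_sum (f := fun k => (|z k| ^ N) ^ 2)
          (fun _ _ => by positivity) (Finset.mem_univ k)
    have h2 : (1 + ‖z‖) ^ (2 * N) ≤ 2 ^ (2 * N) * polyWeight N z := by
      have h3 : 1 + ‖z‖ ≤ 2 * max 1 ‖z‖ := by
        have := le_max_left 1 ‖z‖
        have := le_max_right 1 ‖z‖
        linarith
      calc (1 + ‖z‖) ^ (2 * N) ≤ (2 * max 1 ‖z‖) ^ (2 * N) := by gcongr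
        _ = 2 ^ (2 * N) * (max 1 ‖z‖) ^ (2 * N) := mul_pow _ _ _
        _ ≤ _ := by
          gcongr
          unfold polyWeight
          rcases max_choice 1 ‖z‖ with h | h <;> rw [h]
          · rw [one_pow]
            have : 0 ≤ ∑ k, (|z k| ^ N) ^ 2 := by positivity
            linarith
          · linarith
    rw [Real.rpow_neg (by positivity), Real.rpow_natCast]
    rw [← div_eq_mul_inv, inv_eq_one_div, div_le_div_iff₀ (polyWeight_pos N z) (by positivity)]
    linarith
  calc ∫⁻ z : Fin n → ℝ, ENNReal.ofReal (polyWeight N z)⁻¹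
      ≤ ∫⁻ z : Fin n → ℝ, ENNReal.ofReal (2 ^ (2 * N) * (1 + ‖z‖) ^ (-((2 * N : ℕ) : ℝ))) :=
        lintegral_mono fun z => ENNReal.ofReal_le_ofReal (hle z)
    _ < ∞ := (h_int.const_mul _).lintegral_lt_top

/-- The measure with density `λⁿ / polyWeight N (λ z)`; its total mass does not depend on `λ`. -/
def dilatedMeasure (n N : ℕ) (lam : ℝ) : Measure (Fin n → ℝ) :=
  volume.withDensity fun z => ENNReal.ofReal (lam ^ n * (polyWeight N (lam • z))⁻¹)

lemma measurable_dilated_density {n N : ℕ} (lam : ℝ) :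
    Measurable fun z : Fin n → ℝ => ENNReal.ofReal (lam ^ n * (polyWeight N (lam • z))⁻¹) := by
  have := (continuous_polyWeight (n := n) N).measurable
  fun_prop

lemma dilatedMeasure_univ {n N : ℕ} {lam : ℝ} (hlam : 0 < lam) :
    dilatedMeasure n N lam Set.univ = ∫⁻ z : Fin n → ℝ, ENNReal.ofReal (polyWeight N z)⁻¹ := by
  have hm : Measurable fun z : Fin n → ℝ => ENNReal.ofReal (polyWeight N z)⁻¹ := by
    have := (continuous_polyWeight (n := n) N).measurable
    fun_prop
  have h := lintegral_map (μ := volume) hm (measurable_const_smul lam)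
  rw [Measure.map_addHaar_smul volume hlam.ne', lintegral_smul_measure] at h
  rw [dilatedMeasure, withDensity_apply _ MeasurableSet.univ, Measure.restrict_univ]
  simp only [ENNReal.ofReal_mul (pow_nonneg hlam.le n)]
  rw [lintegral_const_mul' _ _ ENNReal.ofReal_ne_top, ← h, smul_eq_mul, ← mul_assoc,
    ← ENNReal.ofReal_mul (by positivity)]
  simp only [Module.finrank_fintype_fun_eq_card, Fintype.card_fin]
  rw [abs_of_pos (by positivity), mul_inv_cancel₀ (by positivity), ENNReal.ofReal_one, one_mul]

lemma lintegral_mul_sq_le {α : Type*} [MeasurableSpace α] (μ : Measure α) {f g : α → ℝ≥0∞}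
    (hf : AEMeasurable f μ) (hg : AEMeasurable g μ) :
    (∫⁻ a, f a * g a ∂μ) ^ 2 ≤ (∫⁻ a, f a ^ 2 ∂μ) * ∫⁻ a, g a ^ 2 ∂μ := by
  have h := ENNReal.lintegral_mul_le_Lp_mul_Lq μ Real.HolderConjugate.two_two hf hg
  simp only [Pi.mul_apply, ENNReal.rpow_two] at h
  calc (∫⁻ a, f a * g a ∂μ) ^ 2
      ≤ ((∫⁻ a, f a ^ 2 ∂μ) ^ (1 / 2 : ℝ) * (∫⁻ a, g a ^ 2 ∂μ) ^ (1 / 2 : ℝ)) ^ 2 := by gcongr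
    _ = _ := by
      rw [mul_pow, ← ENNReal.rpow_two, ← ENNReal.rpow_two, ← ENNReal.rpow_mul, ← ENNReal.rpow_mul]
      norm_num

lemma lintegral_enorm_sq_le_of_tsupport {n : ℕ} {h : (Fin n → ℝ) → ℂ} {a R : ℝ} (hR : 0 ≤ R)
    (hs : tsupport h ⊆ Metric.closedBall 0 R) (ha : ∀ ξ, ‖h ξ‖ ≤ a) :
    ∫⁻ ξ, ‖h ξ‖ₑ ^ 2 ≤ ENNReal.ofReal ((2 * R) ^ n * a ^ 2) := by
  have ha0 : 0 ≤ a := (norm_nonneg _).trans (ha 0)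
  calc ∫⁻ ξ, ‖h ξ‖ₑ ^ 2
      ≤ ∫⁻ ξ, (Metric.closedBall (0 : Fin n → ℝ) R).indicator
          (fun _ => ENNReal.ofReal (a ^ 2)) ξ := by
        refine lintegral_mono fun ξ => ?_
        by_cases hξ : ξ ∈ Metric.closedBall (0 : Fin n → ℝ) R
        · rw [Set.indicator_of_mem hξ, ENNReal.ofReal_pow ha0]
          gcongr
          rw [← ofReal_norm]
          exact ENNReal.ofReal_le_ofReal (ha ξ)
        · have : h ξ = 0 := by
            by_contra h0
            exact hξ (hs (subset_tsupport h h0))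
          simp [this]
    _ = _ := by
        rw [lintegral_indicator_const Metric.isClosed_closedBall.measurableSet,
          Real.volume_pi_closedBall _ hR, ← ENNReal.ofReal_mul (by positivity), mul_comm,
          Fintype.card_fin]

lemma enorm_integral_piece_sq_le {n N : ℕ} (g u : SchwartzMap (Fin n → ℝ) ℂ)
    (x : Fin n → ℝ) {a R lam : ℝ} (hR : 0 ≤ R) (hlam : 0 < lam)
    (hsupp : tsupport g ⊆ Metric.closedBall 0 R) (h0 : ∀ ξ, ‖g ξ‖ ≤ a)
    (hN : ∀ k ξ, lam ^ N * ‖(pd k)^[N] g ξ‖ ≤ a) :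
    ‖∫ ξ, Complex.exp (2 * (π : ℂ) * Complex.I * ∑ j, (x j : ℂ) * (ξ j : ℂ)) * g ξ * FT u ξ‖ₑ ^ 2
      ≤ ENNReal.ofReal ((n + 1) * ((2 * R) ^ n * a ^ 2) / lam ^ n) *
        ∫⁻ z, ‖u (x + z)‖ₑ ^ 2 ∂(dilatedMeasure n N lam) := by
  have hw (z : Fin n → ℝ) := polyWeight_pos N (lam • z)
  have hln : 0 < lam ^ n := by positivity
  have hdual : ∫ ξ, Complex.exp (2 * (π : ℂ) * Complex.I * ∑ j, (x j : ℂ) * (ξ j : ℂ)) * g ξ *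
      FT u ξ = ∫ z, FT g z * u (x + z) := by
    rw [← integral_mul_FT g.integrable (u.integrable.comp_add_left x)]
    refine integral_congr_ae (Filter.Eventually.of_forall fun ξ => ?_)
    simp only [FT_comp_add]
    ring
  set q : (Fin n → ℝ) → ℝ := fun z => lam ^ n * (polyWeight N (lam • z))⁻¹ with hq
  have hq0 (z) : 0 < q z := mul_pos hln (inv_pos.2 (hw z))
  have hqm : Measurable q := by
    have := (continuous_polyWeight (n := n) N).measurable
    fun_prop
  have hFm : Measurable (FT g) := by
    rw [← coe_schwartzFT]
    exact (schwartzFT g).continuous.measurable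
  have hum : Measurable u := u.continuous.measurable
  let h (k : Fin n) : SchwartzMap (Fin n → ℝ) ℂ :=
    (fun f : SchwartzMap (Fin n → ℝ) ℂ => ∂_{(Pi.single k 1 : Fin n → ℝ)} f)^[N] g
  have hh (k : Fin n) : ⇑(h k) = (pd k)^[N] g := coe_lineDeriv_iterate g k N
  have hpt (z : Fin n → ℝ) : ENNReal.ofReal (q z)⁻¹ * ‖FT g z‖ₑ ^ 2 ≤
      ENNReal.ofReal (lam ^ n)⁻¹ *
        (‖FT g z‖ₑ ^ 2 + ∑ k, ENNReal.ofReal (lam ^ N) ^ 2 * ‖FT (h k) z‖ₑ ^ 2) := by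
    simp only [← ofReal_norm, ← ENNReal.ofReal_pow (norm_nonneg _),
      ← ENNReal.ofReal_pow (pow_nonneg hlam.le N)]
    simp only [← ENNReal.ofReal_mul (sq_nonneg (lam ^ N))]
    rw [← ENNReal.ofReal_sum_of_nonneg (fun _ _ => by positivity),
      ← ENNReal.ofReal_add (by positivity) (Finset.sum_nonneg fun _ _ => by positivity),
      ← ENNReal.ofReal_mul (inv_nonneg.2 (hq0 z).le), ← ENNReal.ofReal_mul (inv_nonneg.2 hln.le)]
    refine ENNReal.ofReal_le_ofReal ?_
    simp only [hq, mul_inv, inv_inv, mul_assoc]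
    gcongr
    simp only [h, norm_FT_lineDeriv_iterate, polyWeight, add_mul, one_mul, Finset.sum_mul]
    refine add_le_add le_rfl (Finset.sum_le_sum fun k _ => ?_)
    have h1 : (1 : ℝ) ≤ (2 * π) ^ N := one_le_pow₀ (by linarith [Real.pi_gt_three])
    simp only [Pi.smul_apply, smul_eq_mul, abs_mul, mul_pow, abs_of_pos hlam]
    calc _ = 1 ^ 2 * ((lam ^ N) ^ 2 * ((|z k| ^ N) ^ 2 * ‖FT g z‖ ^ 2)) := by ring
      _ ≤ ((2 * π) ^ N) ^ 2 * ((lam ^ N) ^ 2 * ((|z k| ^ N) ^ 2 * ‖FT g z‖ ^ 2)) := by gcongr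
      _ = _ := by ring
  have hk (k : Fin n) : ENNReal.ofReal (lam ^ N) ^ 2 * ∫⁻ z, ‖FT (h k) z‖ₑ ^ 2 ≤
      ENNReal.ofReal ((2 * R) ^ n * a ^ 2) := by
    rw [lintegral_enorm_sq_FT, ← lintegral_const_mul' _ _ (by finiteness)]
    have hts : tsupport (fun ξ => ((lam ^ N : ℝ) : ℂ) * h k ξ) ⊆ Metric.closedBall 0 R := by
      refine (closure_mono ?_).trans ((tsupport_pd_iterate_subset g k N).trans hsupp)
      rw [← hh]
      exact Function.support_mul_subset_right _ _
    refine le_trans (le_of_eq ?_) (lintegral_enorm_sq_le_of_tsupport hR hts fun ξ => ?_)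
    · refine lintegral_congr fun ξ => ?_
      rw [enorm_mul, mul_pow, ← ofReal_norm (((lam ^ N : ℝ) : ℂ)), Complex.norm_real,
        Real.norm_of_nonneg (by positivity)]
    · rw [norm_mul, Complex.norm_real, Real.norm_of_nonneg (by positivity), hh]
      exact hN k ξ
  have hF : ∫⁻ z, ENNReal.ofReal (q z)⁻¹ * ‖FT g z‖ₑ ^ 2 ≤
      ENNReal.ofReal ((n + 1) * ((2 * R) ^ n * a ^ 2) / lam ^ n) := by
    have hFk (k : Fin n) : Measurable fun z => ENNReal.ofReal (lam ^ N) ^ 2 * ‖FT (h k) z‖ₑ ^ 2 := by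
      rw [← coe_schwartzFT]
      have := (schwartzFT (h k)).continuous.measurable
      fun_prop
    refine (lintegral_mono hpt).trans ?_
    rw [lintegral_const_mul' _ _ ENNReal.ofReal_ne_top, lintegral_add_left (by fun_prop),
      lintegral_finsetSum _ fun k _ => hFk k, lintegral_enorm_sq_FT, div_eq_inv_mul,
      ENNReal.ofReal_mul (by positivity)]
    simp only [lintegral_const_mul' _ _ (ENNReal.pow_ne_top (ENNReal.ofReal_ne_top (r := lam ^ N)))]
    gcongr
    calc _ ≤ ENNReal.ofReal ((2 * R) ^ n * a ^ 2) +
          ∑ _k : Fin n, ENNReal.ofReal ((2 * R) ^ n * a ^ 2) := by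
          gcongr with k
          · exact lintegral_enorm_sq_le_of_tsupport hR hsupp h0
          · exact hk k
      _ = _ := by
          rw [ENNReal.ofReal_mul (p := (n + 1 : ℝ)) (by positivity),
            ENNReal.ofReal_add (by positivity) zero_le_one,
            Finset.sum_const, Finset.card_univ, Fintype.card_fin, nsmul_eq_mul,
            ENNReal.ofReal_natCast, ENNReal.ofReal_one]
          ring
  have hsq (z) : ENNReal.ofReal √((q z)⁻¹) ^ 2 = ENNReal.ofReal (q z)⁻¹ := by
    rw [← ENNReal.ofReal_pow (Real.sqrt_nonneg _), Real.sq_sqrt (inv_nonneg.2 (hq0 z).le)]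
  have hsq' (z) : ENNReal.ofReal √(q z) ^ 2 = ENNReal.ofReal (q z) := by
    rw [← ENNReal.ofReal_pow (Real.sqrt_nonneg _), Real.sq_sqrt (hq0 z).le]
  have hone (z) : ENNReal.ofReal √((q z)⁻¹) * ENNReal.ofReal √(q z) = 1 := by
    rw [← ENNReal.ofReal_mul (Real.sqrt_nonneg _), ← Real.sqrt_mul (inv_nonneg.2 (hq0 z).le),
      inv_mul_cancel₀ (hq0 z).ne', Real.sqrt_one, ENNReal.ofReal_one]
  rw [hdual]
  calc ‖∫ z, FT g z * u (x + z)‖ₑ ^ 2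
      ≤ (∫⁻ z, ‖FT g z * u (x + z)‖ₑ) ^ 2 := by
        gcongr
        exact enorm_integral_le_lintegral_enorm _
    _ = (∫⁻ z, (ENNReal.ofReal √((q z)⁻¹) * ‖FT g z‖ₑ) *
          (ENNReal.ofReal √(q z) * ‖u (x + z)‖ₑ)) ^ 2 := by
        congr 1
        refine lintegral_congr fun z => ?_
        rw [mul_mul_mul_comm, hone, one_mul, enorm_mul]
    _ ≤ (∫⁻ z, (ENNReal.ofReal √((q z)⁻¹) * ‖FT g z‖ₑ) ^ 2) *
          ∫⁻ z, (ENNReal.ofReal √(q z) * ‖u (x + z)‖ₑ) ^ 2 :=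
        lintegral_mul_sq_le _ (by fun_prop) (by fun_prop)
    _ = (∫⁻ z, ENNReal.ofReal (q z)⁻¹ * ‖FT g z‖ₑ ^ 2) *
          ∫⁻ z, ENNReal.ofReal (q z) * ‖u (x + z)‖ₑ ^ 2 := by
        simp only [mul_pow, hsq, hsq']
    _ ≤ _ := by
        rw [dilatedMeasure, lintegral_withDensity_eq_lintegral_mul _
          (measurable_dilated_density lam) (by fun_prop)]
        exact mul_le_mul_left hF _

/-- If `|F(x)|²` is dominated by an average of `|u(x + ·)|²` against a finite measure, then
`F` is controlled by `u` in every `L^p` with `p ≥ 2`. -/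
lemma eLpNorm_le_of_enorm_sq_le {n : ℕ} {μ : Measure (Fin n → ℝ)} [IsFiniteMeasure μ]
    (hμ : μ ≪ volume) {u F : (Fin n → ℝ) → ℂ} (hu : Continuous u)
    (h : ∀ x, ‖F x‖ₑ ^ 2 ≤ ∫⁻ z, ‖u (x + z)‖ₑ ^ 2 ∂μ) {p : ℝ≥0∞} (hp : 2 ≤ p) :
    eLpNorm F p volume ≤ μ Set.univ ^ (1 / 2 : ℝ) * eLpNorm u p volume := by
  have hF (x) : ‖F x‖ₑ ≤ eLpNorm (fun z => u (x + z)) p μ *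
      μ Set.univ ^ (1 / 2 - 1 / p.toReal) := by
    refine le_trans ?_ ((eLpNorm_le_eLpNorm_mul_rpow_measure_univ (μ := μ) hp
      (by fun_prop : Continuous fun z => u (x + z)).aestronglyMeasurable).trans (by simp))
    rw [eLpNorm_eq_lintegral_rpow_enorm_toReal (by simp) (by simp)]
    simp only [ENNReal.toReal_ofNat, ENNReal.rpow_two]
    rw [one_div, ENNReal.le_rpow_inv_iff two_pos, ENNReal.rpow_two]
    exact h x
  rcases eq_or_ne p ∞ with rfl | hpt
  · rw [eLpNorm_exponent_top]
    refine eLpNormEssSup_le_of_ae_enorm_bound (Filter.Eventually.of_forall fun x => ?_)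
    refine (hF x).trans ?_
    rw [mul_comm]
    simp only [toReal_top, _root_.div_zero, sub_zero, eLpNorm_exponent_top]
    gcongr
    calc eLpNormEssSup (fun z => u (x + z)) μ ≤ eLpNormEssSup (fun z => u (x + z)) volume :=
          essSup_mono_measure hμ
      _ = eLpNorm (u ∘ (x + ·)) ∞ volume := by simp [Function.comp_def]
      _ = _ := by
          rw [eLpNorm_comp_measurePreserving hu.aestronglyMeasurable
            (measurePreserving_add_left volume x), eLpNorm_exponent_top]
  · have hp0 : p ≠ 0 := (two_pos.trans_le hp).ne'
    have hpp : 0 < p.toReal := ENNReal.toReal_pos hp0 hpt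
    have hp2 : 2 ≤ p.toReal := by simpa using ENNReal.toReal_mono hpt hp
    have hum := hu.measurable
    rw [eLpNorm_eq_lintegral_rpow_enorm_toReal hp0 hpt,
      eLpNorm_eq_lintegral_rpow_enorm_toReal hp0 hpt, one_div, ENNReal.rpow_inv_le_iff hpp]
    set J := ∫⁻ x, ‖u x‖ₑ ^ p.toReal
    set M := μ Set.univ
    calc ∫⁻ x, ‖F x‖ₑ ^ p.toReal
        ≤ ∫⁻ x, (∫⁻ z, ‖u (x + z)‖ₑ ^ p.toReal ∂μ) *
            (M ^ (1 / 2 - 1 / p.toReal)) ^ p.toReal := by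
          refine lintegral_mono fun x => ?_
          refine (ENNReal.rpow_le_rpow (hF x) hpp.le).trans_eq ?_
          rw [ENNReal.mul_rpow_of_nonneg _ _ hpp.le,
            eLpNorm_eq_lintegral_rpow_enorm_toReal hp0 hpt, ← ENNReal.rpow_mul,
            one_div_mul_cancel hpp.ne', ENNReal.rpow_one]
      _ = (∫⁻ z, ∫⁻ x, ‖u (x + z)‖ₑ ^ p.toReal ∂volume ∂μ) *
            (M ^ (1 / 2 - 1 / p.toReal)) ^ p.toReal := by
          have hm : Measurable fun q : (Fin n → ℝ) × (Fin n → ℝ) =>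
              ‖u (q.1 + q.2)‖ₑ ^ p.toReal := by fun_prop
          rw [lintegral_mul_const _ hm.lintegral_prod_right', lintegral_lintegral_swap
            hm.aemeasurable]
      _ = J * M * (M ^ (1 / 2 - 1 / p.toReal)) ^ p.toReal := by
          have hz (z : Fin n → ℝ) : ∫⁻ x, ‖u (x + z)‖ₑ ^ p.toReal = J :=
            lintegral_add_right_eq_self (fun x => ‖u x‖ₑ ^ p.toReal) z
          simp only [hz, lintegral_const, M]
      _ ≤ _ := by
          have h0 : 0 ≤ 1 / 2 - 1 / p.toReal := by
            rw [sub_nonneg]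
            exact one_div_le_one_div_of_le two_pos hp2
          rw [ENNReal.mul_rpow_of_nonneg _ _ hpp.le, ← ENNReal.rpow_mul, ← ENNReal.rpow_mul,
            ← ENNReal.rpow_mul, inv_mul_cancel₀ hpp.ne', ENNReal.rpow_one, mul_assoc, mul_comm]
          gcongr
          nth_rewrite 1 [← ENNReal.rpow_one M]
          rw [← ENNReal.rpow_add_of_nonneg _ _ zero_le_one (by positivity)]
          refine le_of_eq (congrArg _ ?_)
          field_simp
          ring

lemma tsum_mul_sq_le (b s : ℕ → ℝ≥0∞) :
    (∑' j, b j * s j) ^ 2 ≤ (∑' j, b j) * ∑' j, b j * s j ^ 2 := by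
  have h := lintegral_mul_sq_le (Measure.count : Measure ℕ)
    (f := fun j => b j ^ (1 / 2 : ℝ)) (g := fun j => b j ^ (1 / 2 : ℝ) * s j)
    (by fun_prop) (by fun_prop)
  simp only [lintegral_count, mul_pow, ← mul_assoc] at h
  have e (j) : b j ^ (1 / 2 : ℝ) * b j ^ (1 / 2 : ℝ) = b j := by
    rw [← ENNReal.rpow_add_of_nonneg _ _ (by norm_num) (by norm_num)]
    norm_num
  simpa only [sq, e, ← mul_assoc] using h

lemma summable_comp_pow_of_integrableOn {ω : ℝ → ℝ} (hω_nonneg : ∀ t, 0 ≤ t → 0 ≤ ω t)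
    (hω_mono : MonotoneOn ω (Set.Ici (0 : ℝ)))
    (hω_int : IntegrableOn (fun t => ω t * t⁻¹) (Set.Ioc (0 : ℝ) 1) volume)
    {r : ℝ} (hr0 : 0 < r) (hr1 : r < 1) : Summable fun j : ℕ => ω (r ^ j) := by
  rw [← summable_nat_add_iff 1]
  have h_int (j : ℕ) : IntervalIntegrable (fun t => ω t * t⁻¹) volume (r ^ (j + 1)) (r ^ j) := by
    rw [intervalIntegrable_iff_integrableOn_Ioc_of_le (pow_le_pow_of_le_one hr0.le hr1.le (by omega))]
    exact hω_int.mono_set (Set.Ioc_subset_Ioc (by positivity) (pow_le_one₀ hr0.le hr1.le))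
  have hpos (t : ℝ) (ht : t ∈ Set.Ioc (0 : ℝ) 1) : 0 ≤ ω t * t⁻¹ :=
    mul_nonneg (hω_nonneg t ht.1.le) (inv_nonneg.2 ht.1.le)
  have hterm (j : ℕ) : ω (r ^ (j + 1)) * (1 - r) ≤ ∫ t in (r ^ (j + 1))..(r ^ j), ω t * t⁻¹ := by
    have hle : r ^ (j + 1) ≤ r ^ j := pow_le_pow_of_le_one hr0.le hr1.le (by omega)
    have hj : 0 < r ^ j := by positivity
    calc ω (r ^ (j + 1)) * (1 - r)
        = ∫ t in (r ^ (j + 1))..(r ^ j), ω (r ^ (j + 1)) * (r ^ j)⁻¹ := by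
          rw [intervalIntegral.integral_const, smul_eq_mul]
          field_simp
          ring
      _ ≤ _ := by
          refine intervalIntegral.integral_mono_on hle (by simp) (h_int j) fun t ht => ?_
          have h1 : 0 < r ^ (j + 1) := by positivity
          have ht0 : 0 < t := h1.trans_le ht.1
          have := hω_mono (Set.mem_Ici.2 h1.le) (Set.mem_Ici.2 ht0.le) ht.1
          have := hω_nonneg _ ht0.le
          gcongr
          exact ht.2
  have hs : Summable fun j : ℕ => ω (r ^ (j + 1)) * (1 - r) := by
    refine summable_of_sum_range_le (c := ∫ t in Set.Ioc (0 : ℝ) 1, ω t * t⁻¹)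
      (fun j => mul_nonneg (hω_nonneg _ (by positivity)) (by linarith)) fun J => ?_
    calc ∑ j ∈ Finset.range J, ω (r ^ (j + 1)) * (1 - r)
        ≤ ∑ j ∈ Finset.range J, ∫ t in (r ^ (j + 1))..(r ^ j), ω t * t⁻¹ :=
          Finset.sum_le_sum fun j _ => hterm j
      _ = ∫ t in (r ^ J)..1, ω t * t⁻¹ := by
          have h := intervalIntegral.sum_integral_adjacent_intervals (n := J) (μ := volume)
            (f := fun t => ω t * t⁻¹) (a := fun j => r ^ j) fun j _ => (h_int j).symm
          have h2 := congrArg Neg.neg h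
          rw [← Finset.sum_neg_distrib] at h2
          simp only [← intervalIntegral.integral_symm, pow_zero] at h2
          exact h2
      _ ≤ _ := by
          rw [intervalIntegral.integral_of_le (pow_le_one₀ hr0.le hr1.le)]
          exact setIntegral_mono_set hω_int ((ae_restrict_iff' measurableSet_Ioc).2
            (Filter.Eventually.of_forall hpos))
            (Set.Ioc_subset_Ioc_left (by positivity)).eventuallyLE
  exact (summable_mul_right_iff (by linarith)).1 hs

lemma one_le_jbR {n : ℕ} (ξ : Fin n → ℝ) : 1 ≤ jbR ξ := by
  rw [jbR, Real.one_le_sqrt]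
  have : 0 ≤ ∑ j, ξ j ^ 2 := by positivity
  linarith

lemma norm_le_jbR {n : ℕ} (ξ : Fin n → ℝ) : ‖ξ‖ ≤ jbR ξ := by
  refine (pi_norm_le_iff_of_nonneg (zero_le_one.trans (one_le_jbR ξ))).2 fun k => ?_
  refine Real.le_sqrt_of_sq_le ?_
  rw [Real.norm_eq_abs, sq_abs]
  have := Finset.single_le_sum (f := fun j => ξ j ^ 2) (fun _ _ => sq_nonneg _)
    (Finset.mem_univ k)
  linarith

/-- A smooth cutoff, equal to `1` on the unit ball and supported in the ball of radius `2`. -/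
def ballCutoff (n : ℕ) (ξ : Fin n → ℝ) : ℂ :=
  ((⟨1, 2, one_pos, one_lt_two⟩ : ContDiffBump (0 : Fin n → ℝ)) ξ : ℝ)

lemma contDiff_ballCutoff (n : ℕ) : ContDiff ℝ (⊤ : ℕ∞) (ballCutoff n) :=
  Complex.ofRealCLM.contDiff.comp (ContDiffBump.contDiff _)

lemma norm_ballCutoff_le (n : ℕ) (ξ : Fin n → ℝ) : ‖ballCutoff n ξ‖ ≤ 1 := by
  rw [ballCutoff, Complex.norm_real, Real.norm_of_nonneg (ContDiffBump.nonneg _)]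
  exact ContDiffBump.le_one _

lemma ballCutoff_eq_one {n : ℕ} {ξ : Fin n → ℝ} (h : ‖ξ‖ ≤ 1) : ballCutoff n ξ = 1 := by
  rw [ballCutoff, ContDiffBump.one_of_mem_closedBall _ (by simpa using h), Complex.ofReal_one]

lemma ballCutoff_eq_zero {n : ℕ} {ξ : Fin n → ℝ} (h : 2 ≤ ‖ξ‖) : ballCutoff n ξ = 0 := by
  rw [ballCutoff, ContDiffBump.zero_of_le_dist _ (by simpa using h), Complex.ofReal_zero]

/-- The pieces of the dyadic (Littlewood-Paley) partition of unity. -/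
def dyadicPiece (n : ℕ) : ℕ → (Fin n → ℝ) → ℂ
  | 0, ξ => ballCutoff n ξ
  | j + 1, ξ => ballCutoff n ((2⁻¹ : ℝ) ^ (j + 1) • ξ) - ballCutoff n ((2⁻¹ : ℝ) ^ j • ξ)

lemma sum_dyadicPiece (n J : ℕ) (ξ : Fin n → ℝ) :
    ∑ j ∈ Finset.range (J + 1), dyadicPiece n j ξ = ballCutoff n ((2⁻¹ : ℝ) ^ J • ξ) := by
  induction J with
  | zero => simp [dyadicPiece]
  | succ J ih => rw [Finset.sum_range_succ, ih, dyadicPiece, add_sub_cancel]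

lemma contDiff_dyadicPiece (n j : ℕ) : ContDiff ℝ (⊤ : ℕ∞) (dyadicPiece n j) := by
  have h := contDiff_ballCutoff n
  cases j with
  | zero => exact h
  | succ j => exact (h.comp (contDiff_const_smul _)).sub (h.comp (contDiff_const_smul _))

lemma tsupport_dyadicPiece_subset_closedBall (n j : ℕ) :
    tsupport (dyadicPiece n j) ⊆ Metric.closedBall 0 (2 * 2 ^ j) := by
  refine closure_minimal (fun ξ hξ => ?_) Metric.isClosed_closedBall
  rw [mem_closedBall_zero_iff]
  by_contra! hlt
  have h2 : 2 ≤ ‖(2⁻¹ : ℝ) ^ j • ξ‖ := by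
    rw [norm_smul, norm_pow, norm_inv, Real.norm_ofNat, inv_pow, inv_mul_eq_div,
      le_div_iff₀ (by positivity)]
    exact hlt.le
  refine hξ ?_
  cases j with
  | zero =>
    rw [pow_zero, one_smul] at h2
    exact ballCutoff_eq_zero h2
  | succ j =>
    have h3 : 2 ≤ ‖(2⁻¹ : ℝ) ^ j • ξ‖ := by
      rw [pow_succ', mul_smul, norm_smul] at h2
      norm_num at h2 ⊢
      linarith [norm_nonneg ((1 / 2 : ℝ) ^ j • ξ)]
    rw [dyadicPiece, ballCutoff_eq_zero h2, ballCutoff_eq_zero h3, sub_zero]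

lemma le_norm_of_mem_tsupport_dyadicPiece {n j : ℕ} {ξ : Fin n → ℝ}
    (hξ : ξ ∈ tsupport (dyadicPiece n (j + 1))) : 2 ^ j ≤ ‖ξ‖ := by
  refine closure_minimal (t := {ξ : Fin n → ℝ | 2 ^ j ≤ ‖ξ‖}) (fun η hη => ?_)
    (isClosed_le continuous_const continuous_norm) hξ
  by_contra hlt
  rw [Set.mem_ofPred_eq, not_le] at hlt
  have h1 : ‖(2⁻¹ : ℝ) ^ j • η‖ ≤ 1 := by
    rw [norm_smul, norm_pow, norm_inv, Real.norm_ofNat, inv_pow, inv_mul_eq_div,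
      div_le_one (by positivity)]
    exact hlt.le
  have h2 : ‖(2⁻¹ : ℝ) ^ (j + 1) • η‖ ≤ 1 := by
    rw [pow_succ', mul_smul, norm_smul, norm_inv, Real.norm_ofNat]
    linarith
  refine hη ?_
  rw [dyadicPiece, ballCutoff_eq_one h1, ballCutoff_eq_one h2, sub_self]

lemma hasCompactSupport_dyadicPiece (n j : ℕ) : HasCompactSupport (dyadicPiece n j) :=
  (isCompact_closedBall _ _).of_isClosed_subset (isClosed_tsupport _)
    (tsupport_dyadicPiece_subset_closedBall n j)

lemma exists_pd_iterate_dyadicPiece_bound (n N : ℕ) :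
    ∃ B : ℝ, 0 ≤ B ∧ ∀ j, ∀ m ≤ N, ∀ (k : Fin n) (ξ),
      ‖(pd k)^[m] (dyadicPiece n j) ξ‖ ≤ B * ((2 ^ j : ℝ)⁻¹) ^ m := by
  let θ : (Fin n → ℝ) → ℂ := fun η => dyadicPiece n 1 ((2 : ℝ) • η)
  obtain ⟨B₀, hB₀, h₀⟩ := exists_pd_iterate_bound (contDiff_dyadicPiece n 0)
    (hasCompactSupport_dyadicPiece n 0) N
  obtain ⟨B₁, hB₁, h₁⟩ := exists_pd_iterate_bound (θ := θ)
    ((contDiff_dyadicPiece n 1).comp (contDiff_const_smul _))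
    ((hasCompactSupport_dyadicPiece n 1).comp_smul two_ne_zero) N
  refine ⟨max B₀ B₁, le_max_of_le_left hB₀, fun j m hm k ξ => ?_⟩
  cases j with
  | zero => simpa using Or.inl (h₀ m hm k ξ)
  | succ j =>
    have hθ : dyadicPiece n (j + 1) = fun ξ => θ (((2 : ℝ) ^ (j + 1))⁻¹ • ξ) := by
      ext ξ
      simp only [θ, dyadicPiece, smul_smul, inv_pow]
      congr 3 <;> field_simp <;> ring
    rw [hθ, pd_iterate_comp_smul, norm_mul, norm_pow, Complex.norm_real,
      Real.norm_of_nonneg (by positivity), mul_comm]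
    gcongr
    exact (h₁ m hm k _).trans (le_max_right _ _)

lemma enorm_le_tsum_enorm_dyadicPiece {n : ℕ} {s : (Fin n → ℝ) → ℂ} (hs : Continuous s) {A : ℝ}
    (hA : ∀ ξ, ‖s ξ‖ ≤ A) (u : SchwartzMap (Fin n → ℝ) ℂ) (x : Fin n → ℝ) :
    ‖∫ ξ, Complex.exp (2 * (π : ℂ) * Complex.I * ∑ j, (x j : ℂ) * (ξ j : ℂ)) * s ξ * FT u ξ‖ₑ ≤
      ∑' j, ‖∫ ξ, Complex.exp (2 * (π : ℂ) * Complex.I * ∑ j, (x j : ℂ) * (ξ j : ℂ)) *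
        (s ξ * dyadicPiece n j ξ) * FT u ξ‖ₑ := by
  have hexp (ξ : Fin n → ℝ) :
      ‖Complex.exp (2 * (π : ℂ) * Complex.I * ∑ j, (x j : ℂ) * (ξ j : ℂ))‖ = 1 := by
    rw [Complex.norm_exp]
    simp [← Complex.ofReal_mul, ← Complex.ofReal_sum]
  have hu : Continuous (FT u) := coe_schwartzFT u ▸ (schwartzFT u).continuous
  have hui : Integrable (FT u) := coe_schwartzFT u ▸ (schwartzFT u).integrable
  have hA0 : 0 ≤ A := (norm_nonneg _).trans (hA 0)
  have h_int (ψ : (Fin n → ℝ) → ℂ) (hψ : Continuous ψ) {B : ℝ} (hB : ∀ ξ, ‖ψ ξ‖ ≤ B) :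
      Integrable fun ξ => Complex.exp (2 * (π : ℂ) * Complex.I * ∑ j, (x j : ℂ) * (ξ j : ℂ)) *
        (s ξ * ψ ξ) * FT u ξ := by
    refine hui.bdd_mul (c := A * B) (by fun_prop)
      (Filter.Eventually.of_forall fun ξ => ?_)
    rw [norm_mul, norm_mul, hexp, one_mul]
    exact mul_le_mul (hA ξ) (hB ξ) (norm_nonneg _) hA0
  have hsum (J : ℕ) : ∑ j ∈ Finset.range (J + 1), ∫ ξ,
      Complex.exp (2 * (π : ℂ) * Complex.I * ∑ j, (x j : ℂ) * (ξ j : ℂ)) *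
        (s ξ * dyadicPiece n j ξ) * FT u ξ =
      ∫ ξ, Complex.exp (2 * (π : ℂ) * Complex.I * ∑ j, (x j : ℂ) * (ξ j : ℂ)) *
        (s ξ * ballCutoff n ((2⁻¹ : ℝ) ^ J • ξ)) * FT u ξ := by
    rw [← integral_finsetSum]
    · simp only [← sum_dyadicPiece, Finset.mul_sum, Finset.sum_mul]
    · intro j _
      obtain ⟨B, hB⟩ := (contDiff_dyadicPiece n j).continuous.bounded_above_of_compact_support
        (hasCompactSupport_dyadicPiece n j)
      exact h_int _ (contDiff_dyadicPiece n j).continuous hB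
  have hlim : Filter.Tendsto (fun J : ℕ => ∫ ξ,
      Complex.exp (2 * (π : ℂ) * Complex.I * ∑ j, (x j : ℂ) * (ξ j : ℂ)) *
        (s ξ * ballCutoff n ((2⁻¹ : ℝ) ^ J • ξ)) * FT u ξ) Filter.atTop
      (nhds (∫ ξ, Complex.exp (2 * (π : ℂ) * Complex.I * ∑ j, (x j : ℂ) * (ξ j : ℂ)) *
        s ξ * FT u ξ)) := by
    have hc := (contDiff_ballCutoff n).continuous
    refine tendsto_integral_of_dominated_convergence (fun ξ => A * ‖FT u ξ‖)
      (fun J => Continuous.aestronglyMeasurable (by fun_prop)) (hui.norm.const_mul A)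
      (fun J => Filter.Eventually.of_forall fun ξ => ?_)
      (Filter.Eventually.of_forall fun ξ => ?_)
    · rw [norm_mul, norm_mul, norm_mul, hexp, one_mul]
      gcongr
      exact (mul_le_mul (hA ξ) (norm_ballCutoff_le n _) (norm_nonneg _) hA0).trans_eq (mul_one A)
    · have h1 : Filter.Tendsto (fun J : ℕ => (2⁻¹ : ℝ) ^ J • ξ) Filter.atTop (nhds 0) := by
        simpa using (tendsto_pow_atTop_nhds_zero_of_lt_one (r := (2⁻¹ : ℝ)) (by norm_num)
          (by norm_num)).smul_const ξ
      have h2 := (hc.tendsto 0).comp h1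
      rw [ballCutoff_eq_one (by simp)] at h2
      simpa using ((h2.const_mul (s ξ)).const_mul
        (Complex.exp (2 * (π : ℂ) * Complex.I * ∑ j, (x j : ℂ) * (ξ j : ℂ)))).mul_const (FT u ξ)
  refine le_of_tendsto' hlim.enorm fun J => ?_
  rw [← hsum]
  exact (enorm_sum_le _ _).trans (ENNReal.sum_le_tsum _)

lemma exists_enorm_dyadicPiece_sq_le {n : ℕ} (hn : 1 ≤ n) (N : ℕ) {ρ : ℝ} (hρ1 : ρ ≤ 1) :
    ∃ L : ℝ, 0 ≤ L ∧ ∀ (j : ℕ) (w : ℝ) (s : (Fin n → ℝ) → ℂ), 0 ≤ w → ContDiff ℝ (⊤ : ℕ∞) s →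
      (∀ k, ∀ i ≤ N, ∀ ξ ∈ tsupport (dyadicPiece n j),
        ‖(pd k)^[i] s ξ‖ ≤ w * (2 ^ j : ℝ) ^ (-((n : ℝ) / 2) * (1 - ρ) - ρ * i)) →
      ∀ (u : SchwartzMap (Fin n → ℝ) ℂ) (x : Fin n → ℝ),
        ‖∫ ξ, Complex.exp (2 * (π : ℂ) * Complex.I * ∑ j, (x j : ℂ) * (ξ j : ℂ)) *
          (s ξ * dyadicPiece n j ξ) * FT u ξ‖ₑ ^ 2 ≤
          ENNReal.ofReal (L * w) ^ 2 *
            ∫⁻ z, ‖u (x + z)‖ₑ ^ 2 ∂(dilatedMeasure n N ((2 ^ j : ℝ) ^ ρ)) := by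
  obtain ⟨B, hB0, hB⟩ := exists_pd_iterate_dyadicPiece_bound n N
  refine ⟨(n + 1) * 4 ^ n * (2 ^ N * B), by positivity, fun j w s hw hs hbd u x => ?_⟩
  set lam : ℝ := (2 ^ j : ℝ) ^ ρ
  set P : ℝ := (2 ^ j : ℝ) ^ (-((n : ℝ) / 2) * (1 - ρ))
  have h2j : (0 : ℝ) < 2 ^ j := by positivity
  have hlam : 0 < lam := by positivity
  have hP : 0 < P := by positivity
  have hlam_le : (2 ^ j : ℝ)⁻¹ ≤ lam⁻¹ := by
    gcongr
    exact (Real.rpow_le_rpow_of_exponent_le (one_le_pow₀ one_le_two) hρ1).trans_eq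
      (Real.rpow_one _)
  have hpow (i : ℕ) : (2 ^ j : ℝ) ^ (-((n : ℝ) / 2) * (1 - ρ) - ρ * i) = P * lam⁻¹ ^ i := by
    rw [sub_eq_add_neg, Real.rpow_add h2j, Real.rpow_neg h2j.le, Real.rpow_mul_natCast h2j.le,
      inv_pow]
  have hderiv (m : ℕ) (hm : m ≤ N) (k : Fin n) (ξ : Fin n → ℝ) :
      lam ^ m * ‖(pd k)^[m] (fun ξ => s ξ * dyadicPiece n j ξ) ξ‖ ≤ 2 ^ N * B * w * P := by
    have hterm (i : ℕ) (hi : i ∈ Finset.range (m + 1)) :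
        (m.choose i : ℝ) * ‖(pd k)^[i] s ξ‖ * ‖(pd k)^[m - i] (dyadicPiece n j) ξ‖ ≤
          (m.choose i : ℝ) * (B * w * P * lam⁻¹ ^ m) := by
      rw [mul_assoc]
      refine mul_le_mul_of_nonneg_left ?_ (by positivity)
      by_cases hξ : ξ ∈ tsupport (dyadicPiece n j)
      · have hi' : i ≤ m := Nat.lt_succ_iff.1 (Finset.mem_range.1 hi)
        calc _ ≤ (w * (P * lam⁻¹ ^ i)) * (B * lam⁻¹ ^ (m - i)) := by
              refine mul_le_mul ((hbd k i (hi'.trans hm) ξ hξ).trans_eq (by rw [hpow]))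
                ((hB j (m - i) (by omega) k ξ).trans ?_) (norm_nonneg _) (by positivity)
              gcongr
          _ = B * w * P * (lam⁻¹ ^ i * lam⁻¹ ^ (m - i)) := by ring
          _ = _ := by rw [← pow_add, Nat.add_sub_cancel' hi']
      · have : (pd k)^[m - i] (dyadicPiece n j) ξ = 0 :=
          image_eq_zero_of_notMem_tsupport
            fun h => hξ (tsupport_pd_iterate_subset _ k _ h)
        rw [this, norm_zero, mul_zero]
        positivity
    calc _ ≤ lam ^ m * ∑ i ∈ Finset.range (m + 1),
          (m.choose i : ℝ) * (B * w * P * lam⁻¹ ^ m) := by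
          gcongr
          exact (norm_pd_iterate_mul_le hs (contDiff_dyadicPiece n j) k m ξ).trans
            (Finset.sum_le_sum hterm)
      _ = 2 ^ m * (B * w * P) * (lam * lam⁻¹) ^ m := by
          rw [← Finset.sum_mul, ← Nat.cast_sum, Nat.sum_range_choose, mul_pow]
          push_cast
          ring
      _ = 2 ^ m * (B * w * P) := by rw [mul_inv_cancel₀ hlam.ne', one_pow, mul_one]
      _ ≤ 2 ^ N * (B * w * P) := by gcongr; exact one_le_two
      _ = _ := by ring
  have hg : ContDiff ℝ (⊤ : ℕ∞) fun ξ => s ξ * dyadicPiece n j ξ :=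
    hs.mul (contDiff_dyadicPiece n j)
  have hgc : HasCompactSupport fun ξ => s ξ * dyadicPiece n j ξ :=
    (hasCompactSupport_dyadicPiece n j).mul_left
  have hmain := enorm_integral_piece_sq_le (N := N) (hgc.toSchwartzMap hg) u x
    (a := 2 ^ N * B * w * P) (R := 2 * 2 ^ j) (lam := lam) (by positivity) hlam
    ((tsupport_mul_subset_right).trans (tsupport_dyadicPiece_subset_closedBall n j))
    (fun ξ => by simpa using hderiv 0 (Nat.zero_le N) ⟨0, hn⟩ ξ)
    (fun k ξ => hderiv N le_rfl k ξ)
  refine hmain.trans ?_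
  gcongr
  rw [← ENNReal.ofReal_pow (by positivity)]
  refine ENNReal.ofReal_le_ofReal ?_
  have hPlam : P ^ 2 * (2 ^ j : ℝ) ^ n = lam ^ n := by
    rw [← Real.rpow_natCast P, ← Real.rpow_natCast (2 ^ j : ℝ), ← Real.rpow_natCast lam,
      ← Real.rpow_mul h2j.le, ← Real.rpow_mul h2j.le, ← Real.rpow_add h2j]
    congr 1
    push_cast
    ring
  rw [div_le_iff₀ (by positivity), ← hPlam]
  have h1 : (1 : ℝ) ≤ (n + 1) * 4 ^ n :=
    one_le_mul_of_one_le_of_one_le (by linarith [n.cast_nonneg (α := ℝ)])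
      (one_le_pow₀ (by norm_num))
  calc (n + 1) * ((2 * (2 * 2 ^ j : ℝ)) ^ n * (2 ^ N * B * w * P) ^ 2)
      = 1 * ((n + 1) * 4 ^ n) * (2 ^ N * B * w) ^ 2 * (P ^ 2 * (2 ^ j : ℝ) ^ n) := by
        rw [← mul_assoc 2 2, mul_pow (2 * 2 : ℝ)]
        norm_num
        ring
    _ ≤ ((n + 1) * 4 ^ n) * ((n + 1) * 4 ^ n) * (2 ^ N * B * w) ^ 2 *
          (P ^ 2 * (2 ^ j : ℝ) ^ n) := by gcongr
    _ = _ := by ring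

end

/-- If a symbol `σ : ℝⁿ × ℝⁿ → ℂ`, smooth in `ξ`, satisfies
`|∂_ξ^α σ(x,ξ)| ≤ C ω(⟨ξ⟩^{-ε}) ⟨ξ⟩^{-(n/2)(1-ρ) - ρ|α|}` for `|α| ≤ [n/2]+1`, then
`T_σ` is bounded on `L^p(ℝⁿ)` for every `2 ≤ p ≤ ∞`. -/
theorem pseudodiff_Rn_omega_Lp_bounded
    (n : ℕ) (hn : 1 ≤ n) (ρ ε : ℝ)
    (hρ0 : 0 ≤ ρ) (hρ1 : ρ ≤ 1) (hε0 : 0 < ε) (hε1 : ε ≤ 1)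
    (ω : ℝ → ℝ) (hω_nonneg : ∀ t, 0 ≤ t → 0 ≤ ω t)
    (hω_mono : MonotoneOn ω (Set.Ici (0 : ℝ)))
    (hω_bdd : ∃ M : ℝ, ∀ t, 0 ≤ t → ω t ≤ M)
    (hω_int : IntegrableOn (fun t => ω t * t⁻¹) (Set.Ioc (0 : ℝ) 1) volume)
    (σ : (Fin n → ℝ) → (Fin n → ℝ) → ℂ)
    (hσ_smooth : ∀ x, ContDiff ℝ (⊤ : ℕ∞) (σ x))
    (C : ℝ) (hC : 0 < C)
    (hσ : ∀ α : Fin n → ℕ, (∑ j, α j) ≤ n / 2 + 1 →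
      ∀ x ξ : Fin n → ℝ,
        ‖pdM α (σ x) ξ‖ ≤
          C * ω (jbR ξ ^ (-ε)) * jbR ξ ^ (-((n : ℝ) / 2) * (1 - ρ) - ρ * ∑ j, (α j : ℝ))) :
    ∀ p : ℝ≥0∞, 2 ≤ p →
      ∃ C' : ℝ, 0 < C' ∧ ∀ u : SchwartzMap (Fin n → ℝ) ℂ,
        eLpNorm (OpR σ u) p volume ≤ ENNReal.ofReal C' * eLpNorm (⇑u) p volume := by
  intro p hp
  obtain ⟨M, hM⟩ := hω_bdd
  have hM0 : 0 ≤ M := (hω_nonneg 0 le_rfl).trans (hM 0 le_rfl)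
  set N := n / 2 + 1
  set r : ℝ := 2 ^ (-ε) with hr_def
  have hr0 : 0 < r := by positivity
  have hr1 : r < 1 := Real.rpow_lt_one_of_one_lt_of_neg one_lt_two (by linarith)
  set A : ℝ := C * 2 ^ ((n : ℝ) / 2 + N) with hA_def
  have hA0 : 0 < A := by positivity
  let w : ℕ → ℝ := fun j => A * Nat.casesOn j M fun i => ω (r ^ i)
  have hw0 (j : ℕ) : 0 ≤ w j := by
    cases j with
    | zero => exact mul_nonneg hA0.le hM0
    | succ j => exact mul_nonneg hA0.le (hω_nonneg _ (by positivity))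
  have hw : Summable w := by
    rw [← summable_nat_add_iff 1]
    exact (summable_comp_pow_of_integrableOn hω_nonneg hω_mono hω_int hr0 hr1).mul_left A
  have hderiv (x : Fin n → ℝ) (k : Fin n) (i : ℕ) (hi : i ≤ N) (ξ : Fin n → ℝ) :
      ‖(pd k)^[i] (σ x) ξ‖ ≤
        C * ω (jbR ξ ^ (-ε)) * jbR ξ ^ (-((n : ℝ) / 2) * (1 - ρ) - ρ * i) := by
    have h := hσ (Pi.single k i) (by simpa using hi) x ξ
    rwa [pdM_single, ← Nat.cast_sum, Finset.sum_pi_single', if_pos (Finset.mem_univ k)] at h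
  have hexp (i : ℕ) : -((n : ℝ) / 2) * (1 - ρ) - ρ * i ≤ 0 := by
    have h1 : 0 ≤ (n : ℝ) / 2 * (1 - ρ) := mul_nonneg (by positivity) (by linarith)
    have h2 : 0 ≤ ρ * i := by positivity
    linarith
  have hjb0 (ξ : Fin n → ℝ) : 0 < jbR ξ := zero_lt_one.trans_le (one_le_jbR ξ)
  have hω0 (ξ : Fin n → ℝ) : 0 ≤ ω (jbR ξ ^ (-ε)) := hω_nonneg _ (Real.rpow_nonneg (hjb0 ξ).le _)
  have hcrude (x : Fin n → ℝ) (k : Fin n) (i : ℕ) (hi : i ≤ N) (ξ : Fin n → ℝ) :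
      ‖(pd k)^[i] (σ x) ξ‖ ≤ C * M := by
    refine (hderiv x k i hi ξ).trans ?_
    have h1 := Real.rpow_le_one_of_one_le_of_nonpos (one_le_jbR ξ) (hexp i)
    have h2 := hM (jbR ξ ^ (-ε)) (Real.rpow_nonneg (hjb0 ξ).le _)
    exact (mul_le_mul (mul_le_mul_of_nonneg_left h2 hC.le) h1
      (Real.rpow_nonneg (hjb0 ξ).le _) (by positivity)).trans_eq (mul_one _)
  have hdyadic (x : Fin n → ℝ) (j : ℕ) (k : Fin n) (i : ℕ) (hi : i ≤ N) (ξ : Fin n → ℝ)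
      (hξ : ξ ∈ tsupport (dyadicPiece n j)) :
      ‖(pd k)^[i] (σ x) ξ‖ ≤
        w j * (2 ^ j : ℝ) ^ (-((n : ℝ) / 2) * (1 - ρ) - ρ * i) := by
    cases j with
    | zero =>
      refine (hcrude x k i hi ξ).trans ?_
      rw [pow_zero, Real.one_rpow, mul_one]
      refine mul_le_mul_of_nonneg_right (le_mul_of_one_le_right hC.le ?_) hM0
      exact Real.one_le_rpow one_le_two (by positivity)
    | succ j =>
      refine (hderiv x k i hi ξ).trans ?_
      have hj : (2 : ℝ) ^ j ≤ jbR ξ :=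
        (le_norm_of_mem_tsupport_dyadicPiece hξ).trans (norm_le_jbR ξ)
      have h2j : (0 : ℝ) < 2 ^ j := by positivity
      have h1 : jbR ξ ^ (-ε) ≤ r ^ j := by
        rw [hr_def, ← Real.rpow_mul_natCast two_pos.le, mul_comm, Real.rpow_natCast_mul two_pos.le]
        exact Real.rpow_le_rpow_of_nonpos h2j hj (by linarith)
      have h2 : ω (jbR ξ ^ (-ε)) ≤ ω (r ^ j) :=
        hω_mono (Real.rpow_nonneg (hjb0 ξ).le _) (by positivity : 0 ≤ r ^ j) h1
      have h3 : jbR ξ ^ (-((n : ℝ) / 2) * (1 - ρ) - ρ * i) ≤ 2 ^ ((n : ℝ) / 2 + N) *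
          (2 ^ (j + 1) : ℝ) ^ (-((n : ℝ) / 2) * (1 - ρ) - ρ * i) := by
        refine (Real.rpow_le_rpow_of_nonpos h2j hj (hexp i)).trans ?_
        rw [pow_succ, Real.mul_rpow h2j.le two_pos.le, mul_left_comm, ← Real.rpow_add two_pos]
        refine le_mul_of_one_le_right (by positivity) (Real.one_le_rpow one_le_two ?_)
        have hi' : (i : ℝ) ≤ N := by exact_mod_cast hi
        have h4 : ρ * i ≤ 1 * N := mul_le_mul hρ1 hi' (by positivity) zero_le_one
        have h5 : (0 : ℝ) ≤ n / 2 * ρ := by positivity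
        linarith
      calc _ ≤ C * ω (r ^ j) * (2 ^ ((n : ℝ) / 2 + N) *
            (2 ^ (j + 1) : ℝ) ^ (-((n : ℝ) / 2) * (1 - ρ) - ρ * i)) := by
            have hωr := (hω0 ξ).trans h2
            have hjb := hjb0 ξ
            gcongr
        _ = _ := by
            simp only [w, hA_def]
            ring
  obtain ⟨L, hL0, hL⟩ := exists_enorm_dyadicPiece_sq_le hn N hρ1
  let b : ℕ → ℝ≥0∞ := fun j => ENNReal.ofReal (L * w j)
  have hb : ∑' j, b j ≠ ∞ := (hw.mul_left L).tsum_ofReal_ne_top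
  let ν : ℕ → Measure (Fin n → ℝ) := fun j => dilatedMeasure n N ((2 ^ j : ℝ) ^ ρ)
  let μ : Measure (Fin n → ℝ) := (∑' j, b j) • Measure.sum fun j => b j • ν j
  have hμ : μ ≪ volume :=
    (Measure.absolutelyContinuous_sum_left fun j =>
      (withDensity_absolutelyContinuous _ _).smul_left _).smul_left _
  have hμfin : μ Set.univ < ∞ := by
    have hν (j : ℕ) : ν j Set.univ = _ := dilatedMeasure_univ (by positivity)
    simp only [μ, Measure.smul_apply, Measure.sum_apply _ MeasurableSet.univ, smul_eq_mul, hν,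
      ENNReal.tsum_mul_right]
    exact ENNReal.mul_lt_top hb.lt_top (ENNReal.mul_lt_top hb.lt_top
      (lintegral_inv_polyWeight_lt_top (by omega)))
  have : IsFiniteMeasure μ := ⟨hμfin⟩
  have hpt (u : SchwartzMap (Fin n → ℝ) ℂ) (x : Fin n → ℝ) :
      ‖OpR σ u x‖ₑ ^ 2 ≤ ∫⁻ z, ‖u (x + z)‖ₑ ^ 2 ∂μ := by
    have hpiece (j : ℕ) : ‖∫ ξ, Complex.exp (2 * (π : ℂ) * Complex.I *
        ∑ j, (x j : ℂ) * (ξ j : ℂ)) * (σ x ξ * dyadicPiece n j ξ) * FT u ξ‖ₑ ≤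
        b j * (∫⁻ z, ‖u (x + z)‖ₑ ^ 2 ∂ν j) ^ (1 / 2 : ℝ) := by
      have h := ENNReal.rpow_le_rpow (hL j (w j) (σ x) (hw0 j) (hσ_smooth x) (hdyadic x j) u x)
        (by norm_num : (0 : ℝ) ≤ 1 / 2)
      rw [ENNReal.mul_rpow_of_nonneg _ _ (by norm_num), ← ENNReal.rpow_two, ← ENNReal.rpow_two,
        ← ENNReal.rpow_mul, ← ENNReal.rpow_mul] at h
      simpa using h
    calc ‖OpR σ u x‖ₑ ^ 2
        ≤ (∑' j, b j * (∫⁻ z, ‖u (x + z)‖ₑ ^ 2 ∂ν j) ^ (1 / 2 : ℝ)) ^ 2 := by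
          gcongr
          refine (enorm_le_tsum_enorm_dyadicPiece (hσ_smooth x).continuous
            (fun ξ => hcrude x ⟨0, hn⟩ 0 (Nat.zero_le N) ξ) u x).trans ?_
          exact ENNReal.tsum_le_tsum hpiece
      _ ≤ (∑' j, b j) * ∑' j, b j * ((∫⁻ z, ‖u (x + z)‖ₑ ^ 2 ∂ν j) ^ (1 / 2 : ℝ)) ^ 2 :=
          tsum_mul_sq_le _ _
      _ = _ := by
          simp only [μ, lintegral_smul_measure, lintegral_sum_measure, smul_eq_mul,
            ← ENNReal.rpow_two, ← ENNReal.rpow_mul]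
          norm_num
  have hfin : μ Set.univ ^ (1 / 2 : ℝ) ≠ ∞ := ENNReal.rpow_ne_top_of_nonneg (by norm_num) hμfin.ne
  refine ⟨(μ Set.univ ^ (1 / 2 : ℝ)).toReal + 1, by positivity, fun u => ?_⟩
  refine (eLpNorm_le_of_enorm_sq_le hμ u.continuous (hpt u) hp).trans ?_
  gcongr
  rw [← ENNReal.ofReal_toReal hfin]
  exact ENNReal.ofReal_le_ofReal (by simp)
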